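/- Let a, b, x be complex numbers with b + m ≠ 0 for every natural number m. Define, for each natural number k, S(k) = ∑_{j=0}^{k} [(a)_j x^j / ((b)_j · j!)] · [(a)_{k−j} (−x)^{k−j} / ((b)_{k−j} · (k−j)!)]. Then for every natural number k, (k+2)(k+1+b)(k+b)(k+2b) · S(k+2) + (2a+k)(2a−k−2b) · x² · S(k) = 0. -/

import Mathlib

/-- Rising factorial (Pochhammer symbol) `(z)_n` over the complex numbers. -/
noncomputable def poch (z : ℂ) (n : ℕ) : ℂ := (ascPochhammer ℂ n).eval z

open Finset in
/-- Lowering the degree of a weighted Cauchy product by the recurrence of the first factor. -/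
theorem sum_range_lower_left {a b x : ℂ} {u : ℕ → ℂ} (v : ℕ → ℂ)
    (hu : ∀ j : ℕ, ((j : ℂ) + 1) * (b + j) * u (j + 1) = (a + j) * x * u j)
    (p : ℂ → ℂ) (n : ℕ) :
    ∑ j ∈ range (n + 2), p j * (j * (b + j - 1)) * (u j * v (n + 1 - j)) =
      x * ∑ j ∈ range (n + 1), (a + j) * p (j + 1) * (u j * v (n - j)) := by
  rw [sum_range_succ', mul_sum]
  simp only [Nat.cast_zero, zero_mul, mul_zero, add_zero]
  refine sum_congr rfl fun j _ => ?_
  rw [Nat.add_sub_add_right]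
  push_cast
  linear_combination p (j + 1) * v (n - j) * hu j

open Finset in
/-- Lowering the degree of a weighted Cauchy product by the recurrence of the second factor. -/
theorem sum_range_lower_right {a b y : ℂ} (u : ℕ → ℂ) {v : ℕ → ℂ}
    (hv : ∀ j : ℕ, ((j : ℂ) + 1) * (b + j) * v (j + 1) = (a + j) * y * v j)
    (q : ℂ → ℂ) (n : ℕ) :
    ∑ j ∈ range (n + 2), q j * ((n + 1 - j) * (b + n - j)) * (u j * v (n + 1 - j)) =
      y * ∑ j ∈ range (n + 1), (a + n - j) * q j * (u j * v (n - j)) := by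
  rw [sum_range_succ, mul_sum]
  have h_last : ((n : ℂ) + 1 - ((n + 1 : ℕ) : ℂ)) = 0 := by push_cast; ring
  simp only [h_last, zero_mul, mul_zero, add_zero]
  refine sum_congr rfl fun j hj => ?_
  have hjn : j ≤ n := Nat.lt_succ_iff.mp (mem_range.mp hj)
  have h := hv (n - j)
  rw [Nat.cast_sub hjn] at h
  rw [Nat.sub_add_comm hjn]
  linear_combination q j * u j * h

open Finset in
/-- The Cauchy product of two solutions of the `₁F₁` coefficient recurrence at opposite
arguments satisfies a two-step recurrence. -/
theorem cauchy_product_recurrence {a b x : ℂ} {u v : ℕ → ℂ}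
    (hu : ∀ j : ℕ, ((j : ℂ) + 1) * (b + j) * u (j + 1) = (a + j) * x * u j)
    (hv : ∀ j : ℕ, ((j : ℂ) + 1) * (b + j) * v (j + 1) = (a + j) * (-x) * v j) (k : ℕ) :
    ((k : ℂ) + 2) * (k + 1 + b) * (k + b) * (k + 2 * b) *
        ∑ j ∈ range (k + 3), u j * v (k + 2 - j) =
      (2 * a + k) * (k + 2 * b - 2 * a) * x ^ 2 * ∑ j ∈ range (k + 1), u j * v (k - j) := by
  have h₁ := sum_range_lower_left v hu (fun j => 3 * k + 4 + 2 * b - 2 * j) (k + 1)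
  have h₂ := sum_range_lower_right u hv (fun j => k + 2 * b + 2 * j) (k + 1)
  have h₃ := sum_range_lower_left v hu (fun _ => 1) k
  have h₄ := sum_range_lower_right u hv (fun _ => 1) k
  have h_top : ((k : ℂ) + 2) * (k + 1 + b) * (k + 2 * b) *
      ∑ j ∈ range (k + 3), u j * v (k + 2 - j) =
      ∑ j ∈ range (k + 1 + 2), (3 * k + 4 + 2 * b - 2 * j) * (j * (b + j - 1)) *
        (u j * v (k + 1 + 1 - j)) +
      ∑ j ∈ range (k + 1 + 2), (k + 2 * b + 2 * j) *
        (((k + 1 : ℕ) + 1 - j) * (b + (k + 1 : ℕ) - j)) * (u j * v (k + 1 + 1 - j)) := by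
    rw [mul_sum, ← sum_add_distrib]
    refine sum_congr rfl fun j _ => ?_
    push_cast
    ring
  have h_mid : ((k : ℂ) + b) *
      (∑ j ∈ range (k + 1 + 1), (a + j) * (3 * k + 4 + 2 * b - 2 * (j + 1)) *
        (u j * v (k + 1 - j)) -
      ∑ j ∈ range (k + 1 + 1), (a + (k + 1 : ℕ) - j) * (k + 2 * b + 2 * j) *
        (u j * v (k + 1 - j))) =
      (k + 2 * b - 2 * a) *
      (∑ j ∈ range (k + 2), 1 * (j * (b + j - 1)) * (u j * v (k + 1 - j)) -
      ∑ j ∈ range (k + 2), 1 * ((k + 1 - j) * (b + k - j)) * (u j * v (k + 1 - j))) := by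
    rw [← sum_sub_distrib, ← sum_sub_distrib, mul_sum, mul_sum]
    refine sum_congr rfl fun j _ => ?_
    push_cast
    ring
  have h_bot : (2 * a + k) * ∑ j ∈ range (k + 1), u j * v (k - j) =
      ∑ j ∈ range (k + 1), (a + j) * 1 * (u j * v (k - j)) +
      ∑ j ∈ range (k + 1), (a + k - j) * 1 * (u j * v (k - j)) := by
    rw [mul_sum, ← sum_add_distrib]
    refine sum_congr rfl fun j _ => ?_
    ring
  linear_combination (k + b) * (h_top + h₁ + h₂) + x * h_mid +
    x * (k + 2 * b - 2 * a) * (h₃ - h₄) - x ^ 2 * (k + 2 * b - 2 * a) * h_bot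

theorem poch_succ (z : ℂ) (n : ℕ) : poch z (n + 1) = poch z n * (z + n) :=
  ascPochhammer_succ_eval n z

theorem poch_ne_zero {b : ℂ} (hb : ∀ m : ℕ, b + (m : ℂ) ≠ 0) (n : ℕ) : poch b n ≠ 0 := by
  induction n with
  | zero => simp [poch]
  | succ n ih => rw [poch_succ]; exact mul_ne_zero ih (hb n)

/-- The two-term recurrence of the coefficients of `₁F₁(a; b; x)`. -/
theorem kummer_term_succ {a b : ℂ} (hb : ∀ m : ℕ, b + (m : ℂ) ≠ 0) (x : ℂ) (j : ℕ) :
    ((j : ℂ) + 1) * (b + j) *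
        (poch a (j + 1) * x ^ (j + 1) / (poch b (j + 1) * ((j + 1).factorial : ℂ))) =
      (a + j) * x * (poch a j * x ^ j / (poch b j * (j.factorial : ℂ))) := by
  have h₁ := poch_ne_zero hb j
  have h₂ := hb j
  have h₃ : (j.factorial : ℂ) ≠ 0 := Nat.cast_ne_zero.mpr j.factorial_ne_zero
  have h₄ : (j : ℂ) + 1 ≠ 0 := Nat.cast_add_one_ne_zero j
  rw [poch_succ, poch_succ, Nat.factorial_succ]
  push_cast
  field_simp
  ring

theorem stmt_6 (a b x : ℂ) (hb : ∀ m : ℕ, b + (m : ℂ) ≠ 0)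
    (S : ℕ → ℂ)
    (hS : ∀ k : ℕ, S k = ∑ j ∈ Finset.range (k + 1),
      (poch a j * x ^ j / (poch b j * (j.factorial : ℂ))) *
        (poch a (k - j) * (-x) ^ (k - j) / (poch b (k - j) * ((k - j).factorial : ℂ)))) :
    ∀ k : ℕ, ((k : ℂ) + 2) * ((k : ℂ) + 1 + b) * ((k : ℂ) + b) * ((k : ℂ) + 2 * b) * S (k + 2)
      + (2 * a + (k : ℂ)) * (2 * a - (k : ℂ) - 2 * b) * x ^ 2 * S k = 0 := by
  intro k
  have h := cauchy_product_recurrence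
    (u := fun j => poch a j * x ^ j / (poch b j * (j.factorial : ℂ)))
    (v := fun j => poch a j * (-x) ^ j / (poch b j * (j.factorial : ℂ)))
    (kummer_term_succ hb x) (kummer_term_succ hb (-x)) k
  rw [← hS k, ← hS (k + 2)] at h
  linear_combination h
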